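/- Let η : ℝ → ℝ be a Schwartz function, g : ℝ → ℝ a continuous compactly supported function, and n ∈ ℕ. For ε > 0 define g_ε(x) := ∫ η(z) g(x + εz) dz. Then g_ε is a smooth function of x, its n-th derivative satisfies Dⁿ g_ε(x) = (−1/ε)ⁿ ∫ (Dⁿ η)(z) g(x + εz) dz for all x, and there is a constant C such that sup_{x ∈ ℝ} |Dⁿ g_ε(x)| ≤ C ε^{−n} for all ε ∈ (0,1). Hence the mollified embedding of the n-th distributional derivative of g is O(ε^{−n}), i.e., it is a moderate family. -/

import Mathlib

open MeasureTheory

lemma moll_change_var (η g : ℝ → ℝ) (ε : ℝ) (hε : 0 < ε) (x : ℝ) :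
    ∫ z, η z * g (x + ε * z) = ε⁻¹ * ∫ y, η ((y - x) / ε) * g y := by
  have h1 := MeasureTheory.integral_add_left_eq_self (μ := volume)
    (fun y => η ((y - x) / ε) * g y) x
  have h2 := Measure.integral_comp_mul_left
    (fun y => η ((x + y - x) / ε) * g (x + y)) ε
  rw [← h1]
  rw [abs_of_pos (inv_pos.2 hε), smul_eq_mul] at h2
  rw [← h2]
  congr 1
  ext z
  have : (x + ε * z - x) / ε = z := by field_simp; ring
  rw [this]

lemma moll_hasDerivAt (η : SchwartzMap ℝ ℝ) (g : ℝ → ℝ) (hg : Continuous g)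
    (hgc : HasCompactSupport g) (ε : ℝ) (hε : 0 < ε) (x : ℝ) :
    HasDerivAt (fun x : ℝ => ∫ z, η z * g (x + ε * z))
      ((-1 / ε) * ∫ z, SchwartzMap.derivCLM ℝ ℝ η z * g (x + ε * z)) x := by
  have hgi : Integrable g := hg.integrable_of_hasCompactSupport hgc
  obtain ⟨M, hM⟩ : ∃ M, ∀ z, ‖SchwartzMap.derivCLM ℝ ℝ η z‖ ≤ M := by
    obtain ⟨M, hM⟩ := (SchwartzMap.derivCLM ℝ ℝ η).decay 0 0
    exact ⟨M, fun z => by simpa using hM.2 z⟩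
  have hM0 : 0 ≤ M := (norm_nonneg _).trans (hM 0)
  have key := hasDerivAt_integral_of_dominated_loc_of_deriv_le (μ := volume) (𝕜 := ℝ)
    (F := fun x y => η ((y - x) / ε) * g y)
    (F' := fun x y => (SchwartzMap.derivCLM ℝ ℝ η ((y - x) / ε) * (-1 / ε)) * g y)
    (x₀ := x) (s := Set.univ) (bound := fun y => M * (1 / ε) * ‖g y‖) Filter.univ_mem
    (Filter.Eventually.of_forall fun a => by
      have := η.continuous
      exact Continuous.aestronglyMeasurable (by fun_prop))
    (by
      have := η.continuous
      refine Continuous.integrable_of_hasCompactSupport (by fun_prop) ?_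
      exact hgc.mul_left)
    (by
      have := (SchwartzMap.derivCLM ℝ ℝ η).continuous
      exact Continuous.aestronglyMeasurable (by fun_prop))
    (Filter.Eventually.of_forall fun y a _ => by
      rw [norm_mul, norm_mul]
      have : ‖-1 / ε‖ = 1 / ε := by
        rw [norm_div, norm_neg, norm_one, Real.norm_of_nonneg hε.le]
      rw [this]
      gcongr
      exact hM _)
    (hgi.norm.const_mul _)
    (Filter.Eventually.of_forall fun y a _ => by
      have h1 : HasDerivAt (fun a : ℝ => (y - a) / ε) (-1 / ε) a :=
        ((hasDerivAt_id a).const_sub y).div_const ε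
      have h2 : HasDerivAt η (SchwartzMap.derivCLM ℝ ℝ η ((y - a) / ε)) ((y - a) / ε) := by
        rw [SchwartzMap.derivCLM_apply]
        exact η.differentiableAt.hasDerivAt
      exact (h2.comp a h1).mul_const _)
  have h3 := key.2.const_mul ε⁻¹
  have e : (fun x : ℝ => ∫ z, η z * g (x + ε * z)) =
      fun x => ε⁻¹ * ∫ y, η ((y - x) / ε) * g y :=
    funext fun x => moll_change_var η g ε hε x
  rw [e, moll_change_var _ g ε hε x]
  refine h3.congr_deriv ?_
  symm
  rw [mul_left_comm, ← integral_const_mul]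
  congr 2
  ext y
  ring

lemma moll_contDiff (g : ℝ → ℝ) (hg : Continuous g)
    (hgc : HasCompactSupport g) (ε : ℝ) (hε : 0 < ε) (n : ℕ) :
    ∀ η : SchwartzMap ℝ ℝ, ContDiff ℝ n (fun x : ℝ => ∫ z, η z * g (x + ε * z)) := by
  induction n with
  | zero =>
    intro η
    exact contDiff_zero.2 (continuous_iff_continuousAt.2 fun x =>
      (moll_hasDerivAt η g hg hgc ε hε x).continuousAt)
  | succ n ih =>
    intro η
    have hd := moll_hasDerivAt η g hg hgc ε hε
    push_cast
    refine contDiff_succ_iff_deriv.2 ⟨fun x => (hd x).differentiableAt, by simp, ?_⟩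
    rw [funext fun x => (hd x).deriv]
    exact contDiff_const.mul (ih _)

lemma moll_iter (η : SchwartzMap ℝ ℝ) (n : ℕ) :
    (((SchwartzMap.derivCLM ℝ ℝ)^[n] η : SchwartzMap ℝ ℝ) : ℝ → ℝ) =
      iteratedDeriv n (fun z : ℝ => η z) := by
  induction n with
  | zero => simp
  | succ n ih =>
    rw [iteratedDeriv_succ, ← ih, Function.iterate_succ_apply']
    ext x
    rw [SchwartzMap.derivCLM_apply]

lemma moll_iteratedDeriv (η : SchwartzMap ℝ ℝ) (g : ℝ → ℝ) (hg : Continuous g)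
    (hgc : HasCompactSupport g) (ε : ℝ) (hε : 0 < ε) (n : ℕ) :
    iteratedDeriv n (fun x : ℝ => ∫ z, η z * g (x + ε * z)) = fun x =>
      (-1 / ε) ^ n * ∫ z, ((SchwartzMap.derivCLM ℝ ℝ)^[n] η) z * g (x + ε * z) := by
  induction n with
  | zero => simp
  | succ n ih =>
    rw [iteratedDeriv_succ, ih]
    ext x
    rw [((moll_hasDerivAt _ g hg hgc ε hε x).const_mul _).deriv, Function.iterate_succ_apply',
      pow_succ, mul_assoc]

/-- For a Schwartz mollifier `η`, a continuous compactly supported `g`, and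
`n : ℕ`: the mollified embedding `g_ε(x) = ∫ η(z) g(x + εz) dz` is smooth in
`x`, its `n`-th derivative is `(−1/ε)ⁿ ∫ (Dⁿη)(z) g(x + εz) dz`, and it
satisfies a moderateness bound `sup_x |Dⁿ g_ε(x)| ≤ C ε^{−n}` for `ε ∈ (0,1)`. -/
theorem mollified_embedding_deriv_moderate (η : SchwartzMap ℝ ℝ)
    (g : ℝ → ℝ) (hg : Continuous g) (hgc : HasCompactSupport g) (n : ℕ) :
    (∀ ε : ℝ, 0 < ε →
      ContDiff ℝ (⊤ : ℕ∞) (fun x : ℝ => ∫ z, η z * g (x + ε * z)) ∧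
      ∀ x : ℝ,
        iteratedDeriv n (fun x : ℝ => ∫ z, η z * g (x + ε * z)) x =
          (-1 / ε) ^ n * ∫ z, iteratedDeriv n (fun z : ℝ => η z) z * g (x + ε * z)) ∧
    ∃ C : ℝ, ∀ ε ∈ Set.Ioo (0 : ℝ) 1, ∀ x : ℝ,
      |iteratedDeriv n (fun x : ℝ => ∫ z, η z * g (x + ε * z)) x| ≤ C / ε ^ n := by
  refine ⟨fun ε hε => ⟨contDiff_infty.2 fun m => moll_contDiff g hg hgc ε hε m η, fun x => ?_⟩, ?_⟩
  · rw [moll_iteratedDeriv η g hg hgc ε hε n, moll_iter]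
  · obtain ⟨B, hB⟩ := hgc.exists_bound_of_continuous hg
    set ψ : SchwartzMap ℝ ℝ := (SchwartzMap.derivCLM ℝ ℝ)^[n] η with hψ
    refine ⟨∫ z, ‖ψ z‖ * B, fun ε hε x => ?_⟩
    rw [moll_iteratedDeriv η g hg hgc ε hε.1 n]
    have hle : ‖∫ z, ψ z * g (x + ε * z)‖ ≤ ∫ z, ‖ψ z‖ * B := by
      refine norm_integral_le_of_norm_le (ψ.integrable.norm.mul_const B)
        (Filter.Eventually.of_forall fun z => ?_)
      rw [norm_mul]
      gcongr
      exact hB _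
    rw [Real.norm_eq_abs] at hle
    have hp : |(-1 / ε) ^ n| = 1 / ε ^ n := by
      rw [abs_pow, abs_div, abs_neg, abs_one, abs_of_pos hε.1, div_pow, one_pow]
    rw [abs_mul, hp, one_div, div_eq_inv_mul]
    have := hε.1
    gcongr
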